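/- Let K ⊂ ℝ² be a compact sub-uniformly distributed set with dimH(K) = t ∈ (0,2), and let s satisfy t/2 < s ≤ 1. Then for a.e. e ∈ S¹ there is no line ℓ parallel to e with dimH(K ∩ ℓ) ≥ s. -/

import Mathlib

open MeasureTheory Metric Set
open scoped ENNReal NNReal

noncomputable section

/-- The Euclidean plane ℝ². -/
abbrev Plane := EuclideanSpace ℝ (Fin 2)

/-- The unit circle S¹ ⊆ ℝ². -/
def unitCircle : Set Plane := Metric.sphere (0 : Plane) 1

/-- The line `ℓ_{e,z} = z + span(e)` through `z` in direction `e`. -/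
def lineThrough (e z : Plane) : Set Plane := {w | ∃ r : ℝ, w = z + r • e}


/-- The standard (half-open) dyadic cube of side length `2^{-k}` indexed by `m : Fin d → ℤ`. -/
def dyadicCube (d k : ℕ) (m : Fin d → ℤ) : Set (EuclideanSpace ℝ (Fin d)) :=
  {x | ∀ i, (m i : ℝ) * (2 : ℝ) ^ (-(k : ℤ)) ≤ x i ∧
            x i < ((m i : ℝ) + 1) * (2 : ℝ) ^ (-(k : ℤ))}

/-- The dyadic `2^{-k}`-covering number `|P|_{2^{-k}}`: the number of standard dyadic cubes of
side length `2^{-k}` intersecting `P`. -/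
def covNum (d k : ℕ) (P : Set (EuclideanSpace ℝ (Fin d))) : ℕ :=
  Set.ncard {m : Fin d → ℤ | (dyadicCube d k m ∩ P).Nonempty}

/-- A bounded set `K ⊆ ℝ^d` is sub-uniformly distributed if there is `C > 0` with
`|K|_R · |K ∩ Q|_r ≤ C·|K|_r` for all dyadic scales `r = 2^{-k} ≤ R = 2^{-j}` and every dyadic
`R`-cube `Q` intersecting `K`. -/
def SubUniformlyDistributed {d : ℕ} (K : Set (EuclideanSpace ℝ (Fin d))) : Prop :=
  Bornology.IsBounded K ∧ ∃ C : ℝ, 0 < C ∧ ∀ j k : ℕ, j ≤ k → ∀ m : Fin d → ℤ,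
    (dyadicCube d j m ∩ K).Nonempty →
    (covNum d j K : ℝ) * (covNum d k (K ∩ dyadicCube d j m) : ℝ)
      ≤ C * (covNum d k K : ℝ)

lemma mem_dyadicCube_iff (k : ℕ) (m : Fin 2 → ℤ) (x : Plane) :
    x ∈ dyadicCube 2 k m ↔ ∀ i, ⌊x i * 2 ^ k⌋ = m i := by
  have h2 : (0:ℝ) < 2 ^ k := by positivity
  simp only [dyadicCube, Set.mem_ofPred_eq, Int.floor_eq_iff, zpow_neg, zpow_natCast,
    ← div_eq_mul_inv, div_le_iff₀ h2, lt_div_iff₀ h2]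

/-- index of the dyadic cube of level `k` containing `x` -/
def cidx (k : ℕ) (x : Plane) : Fin 2 → ℤ := fun i => ⌊x i * 2 ^ k⌋

lemma mem_cube_iff (k : ℕ) (m : Fin 2 → ℤ) (x : Plane) :
    x ∈ dyadicCube 2 k m ↔ cidx k x = m := by
  rw [mem_dyadicCube_iff, funext_iff]; rfl

/-- cubes of level `k` meeting `A` -/
def cubesOf (k : ℕ) (A : Set Plane) : Set (Fin 2 → ℤ) :=
  {m : Fin 2 → ℤ | (dyadicCube 2 k m ∩ A).Nonempty}

lemma cubesOf_eq (k : ℕ) (A : Set Plane) : cubesOf k A = cidx k '' A := by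
  ext m
  simp only [cubesOf, Set.mem_ofPred_eq, Set.Nonempty, Set.mem_inter_iff, mem_cube_iff, Set.mem_image]
  exact ⟨fun ⟨x, h, h'⟩ => ⟨x, h', h⟩, fun ⟨x, h, h'⟩ => ⟨x, h', h⟩⟩

lemma cidx_anc (j k : ℕ) (h : j ≤ k) (x : Plane) (i : Fin 2) :
    cidx j x i = cidx k x i / ((2 ^ (k - j) : ℕ) : ℤ) := by
  obtain ⟨l, rfl⟩ := Nat.exists_eq_add_of_le h
  simp only [cidx, Nat.add_sub_cancel_left]
  rw [← Int.floor_div_natCast]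
  congr 1
  push_cast
  rw [pow_add]
  field_simp

lemma abs_coord_le (x y : Plane) (i : Fin 2) : |x i - y i| ≤ dist x y := by
  have := PiLp.norm_apply_le (x - y) i
  rw [dist_eq_norm]
  simpa using this

lemma cubesOf_finite (k : ℕ) (A : Set Plane) (hA : Bornology.IsBounded A) :
    (cubesOf k A).Finite := by
  obtain ⟨R, hR⟩ := hA.subset_closedBall 0
  rw [cubesOf_eq]
  apply (Set.finite_Icc (fun _ : Fin 2 => ⌊(-R) * 2 ^ k⌋) (fun _ => ⌊R * 2 ^ k⌋)).subset
  rintro _ ⟨x, hx, rfl⟩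
  have h1 : ∀ i, |x i| ≤ R := fun i => by
    have := abs_coord_le x 0 i
    have h3 : dist x 0 ≤ R := hR hx
    simp at this ⊢
    simp at h3
    linarith
  constructor <;> intro i <;> apply Int.floor_le_floor <;> gcongr
  · exact (abs_le.1 (h1 i)).1
  · exact (abs_le.1 (h1 i)).2

lemma covNum_eq (k : ℕ) (A : Set Plane) : covNum 2 k A = (cubesOf k A).ncard := rfl

lemma cidx_near {j : ℕ} {x y : Plane} {a : ℕ} (h : ∀ i, |x i - y i| ≤ a * (1/2:ℝ)^j) :
    cidx j x ∈ Finset.Icc (fun i => cidx j y i - (a+1)) (fun i => cidx j y i + (a + 1)) := by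
  rw [Finset.mem_Icc]
  have hb : ∀ i, |x i * 2 ^ j - y i * 2 ^ j| ≤ a := fun i => by
    rw [← sub_mul, abs_mul, abs_of_pos (by positivity : (0:ℝ) < 2 ^ j)]
    have := mul_le_mul_of_nonneg_right (h i) (by positivity : (0:ℝ) ≤ 2 ^ j)
    rwa [mul_assoc, ← mul_pow, show (1/2:ℝ)*2 = 1 by norm_num, one_pow, mul_one] at this
  have key : ∀ i, cidx j y i - (a+1) ≤ cidx j x i ∧ cidx j x i ≤ cidx j y i + (a+1) := fun i => by
    have h1 := abs_le.1 (hb i)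
    have h2 := Int.floor_le (x i * 2 ^ j)
    have h3 := Int.lt_floor_add_one (x i * 2 ^ j)
    have h4 := Int.floor_le (y i * 2 ^ j)
    have h5 := Int.lt_floor_add_one (y i * 2 ^ j)
    simp only [cidx]
    constructor
    · have : ((⌊y i * 2 ^ j⌋ : ℤ) : ℝ) < ((⌊x i * 2 ^ j⌋ + (a + 1) : ℤ) : ℝ) := by
        push_cast; linarith
      have := Int.cast_lt.1 this
      omega
    · have : ((⌊x i * 2 ^ j⌋ : ℤ) : ℝ) < ((⌊y i * 2 ^ j⌋ + (a + 1) : ℤ) : ℝ) := by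
        push_cast; linarith
      have := Int.cast_lt.1 this
      omega
  exact ⟨fun i => (key i).1, fun i => (key i).2⟩

lemma card_near (m : Fin 2 → ℤ) (a : ℕ) :
    (Finset.Icc (fun i => m i - ((a:ℤ)+1)) (fun i => m i + ((a:ℤ) + 1))).card = (2*a+3)^2 := by
  rw [Pi.card_Icc]
  simp only [Int.card_Icc, Fin.prod_univ_two, sq]
  congr 1 <;> omega

lemma exists_cover (K : Set Plane) (hK : IsCompact K) (t : ℝ) (ht : 0 < t)
    (h0 : μH[t] K = 0) (ε : ℝ) (hε : 0 < ε) :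
    ∃ (I : Finset ℕ) (x : ℕ → Plane) (j : ℕ → ℕ),
      K ⊆ ⋃ i ∈ I, Metric.ball (x i) ((1/2:ℝ)^(j i)) ∧
      ∑ i ∈ I, ((1/2:ℝ)^(j i))^t ≤ ε := by
  set ε' : ℝ := ε / (3 * 2 ^ t) with hε'
  have hε'0 : 0 < ε' := by positivity
  rw [Measure.hausdorffMeasure_apply] at h0
  have h1 := h0
  simp only [ENNReal.iSup_eq_zero] at h1
  have h2 := h1 (ENNReal.ofReal (1/4)) (by simp)
  have h3 : (⨅ (t_1 : ℕ → Set Plane) (_ : K ⊆ ⋃ n, t_1 n) (_ : ∀ n, ediam (t_1 n) ≤ ENNReal.ofReal (1/4)),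
      ∑' n, ⨆ (_ : (t_1 n).Nonempty), ediam (t_1 n) ^ t) < ENNReal.ofReal ε' := by
    rw [h2]; simpa using hε'0
  simp only [iInf_lt_iff] at h3
  obtain ⟨U, hU, hd, hs⟩ := h3
  -- real diameters
  set D : ℕ → ℝ := fun i => (ediam (U i)).toReal with hD
  have hfin : ∀ i, ediam (U i) ≠ ⊤ := fun i => ((hd i).trans_lt ENNReal.ofReal_lt_top).ne
  have hD0 : ∀ i, 0 ≤ D i := fun i => ENNReal.toReal_nonneg
  have hD1 : ∀ i, D i ≤ 1/4 := fun i => ENNReal.toReal_le_of_le_ofReal (by norm_num) (hd i)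
  have hsum : ∀ I : Finset ℕ, ∑ i ∈ I, D i ^ t ≤ ε' := by
    intro I
    have e1 : ∀ i, (⨆ (_ : (U i).Nonempty), ediam (U i) ^ t) = ENNReal.ofReal (D i ^ t) := by
      intro i
      rw [← ENNReal.ofReal_rpow_of_nonneg (hD0 i) ht.le, ENNReal.ofReal_toReal (hfin i)]
      rcases (U i).eq_empty_or_nonempty with h | h
      · simp [h, ht]
      · simp [h]
    simp only [e1] at hs
    have := (ENNReal.sum_le_tsum I).trans hs.le
    rw [← ENNReal.ofReal_sum_of_nonneg (fun i _ => Real.rpow_nonneg (hD0 i) t)] at this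
    exact (ENNReal.ofReal_le_ofReal_iff hε'0.le).1 this
  -- choose positive radii
  have hη : ∀ i : ℕ, ∃ η : ℝ, 0 < η ∧ η ≤ 1/4 ∧ η ^ t ≤ ε' * (1/2)^i := by
    intro i
    refine ⟨min (1/4) ((ε' * (1/2)^i) ^ (1/t)), by positivity, min_le_left _ _, ?_⟩
    calc _ ≤ ((ε' * (1/2)^i) ^ (1/t))^t := by
          apply Real.rpow_le_rpow (by positivity) (min_le_right _ _) ht.le
      _ = _ := by rw [← Real.rpow_mul (by positivity)]; field_simp; simp
  choose η hη0 hη1 hη2 using hη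
  have hj : ∀ i, ∃ n : ℕ, (1/2:ℝ)^(n+1) ≤ max (D i) (η i) ∧ max (D i) (η i) < (1/2:ℝ)^n := by
    intro i
    obtain ⟨n, h1, h2⟩ := exists_nat_pow_near_of_lt_one (x := max (D i) (η i)) (y := (1/2:ℝ))
      (lt_max_of_lt_right (hη0 i)) (max_le ((hD1 i).trans (by norm_num)) ((hη1 i).trans (by norm_num)))
      (by norm_num) (by norm_num)
    by_cases h : max (D i) (η i) < (1/2:ℝ)^n
    · exact ⟨n, h1.le, h⟩
    · have he := le_antisymm h2 (not_lt.1 h)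
      cases n with
      | zero =>
        exfalso
        have := max_le (hD1 i) (hη1 i)
        rw [he] at this; norm_num at this
      | succ n => exact ⟨n, he.symm.le, he ▸ pow_lt_pow_right_of_lt_one₀ (by norm_num) (by norm_num) (by omega)⟩
  choose j hj1 hj2 using hj
  have hx : ∀ i, ∃ x : Plane, U i ⊆ Metric.ball x ((1/2:ℝ)^(j i)) := by
    intro i
    rcases (U i).eq_empty_or_nonempty with h | ⟨x, hx⟩
    · exact ⟨0, by simp [h]⟩
    · refine ⟨x, fun y hy => ?_⟩
      rw [Metric.mem_ball, dist_edist]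
      refine lt_of_le_of_lt ?_ (lt_of_le_of_lt (le_max_left _ _) (hj2 i))
      exact ENNReal.toReal_mono (hfin i) (Metric.edist_le_ediam_of_mem hy hx)
  choose x hx using hx
  obtain ⟨I, hI⟩ := hK.elim_finite_subcover (fun i => Metric.ball (x i) ((1/2:ℝ)^(j i)))
    (fun i => Metric.isOpen_ball) (hU.trans (Set.iUnion_mono hx))
  refine ⟨I, x, j, hI, ?_⟩
  have hterm : ∀ i, ((1/2:ℝ)^(j i))^t ≤ 2^t * (D i ^ t + ε' * (1/2)^i) := by
    intro i
    have : (1/2:ℝ)^(j i) ≤ 2 * max (D i) (η i) := by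
      have := hj1 i
      rw [pow_succ] at this; linarith
    calc _ ≤ (2 * max (D i) (η i))^t := Real.rpow_le_rpow (by positivity) this ht.le
      _ = 2^t * (max (D i) (η i))^t := Real.mul_rpow (by norm_num) (le_max_of_le_left (hD0 i))
      _ ≤ _ := by
        gcongr
        rcases max_choice (D i) (η i) with h | h <;> rw [h]
        · have : 0 ≤ ε' * (1/2:ℝ)^i := by positivity
          linarith
        · have := Real.rpow_nonneg (hD0 i) t
          linarith [hη2 i]
  calc _ ≤ ∑ i ∈ I, 2^t * (D i ^ t + ε' * (1/2)^i) := Finset.sum_le_sum fun i _ => hterm i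
    _ = 2^t * (∑ i ∈ I, D i ^ t + ε' * ∑ i ∈ I, (1/2:ℝ)^i) := by
      rw [← Finset.mul_sum, Finset.sum_add_distrib, Finset.mul_sum]
    _ ≤ 2^t * (ε' + ε' * 2) := by
      gcongr
      · exact hsum I
      · exact (summable_geometric_two.sum_le_tsum I (fun i _ => by positivity)).trans_eq
          tsum_geometric_two
    _ = ε := by rw [hε']; field_simp; ring

open Filter in
lemma box_bound (K : Set Plane) (hK : IsCompact K) (hne : K.Nonempty)
    (hsub : SubUniformlyDistributed K) (t : ℝ) (ht : 0 < t) (h0 : μH[t] K = 0) :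
    ∃ᶠ k : ℕ in atTop, (covNum 2 k K : ℝ) ≤ ((2:ℝ)^k)^t := by
  obtain ⟨hb, C, hC, hs⟩ := hsub
  by_contra hcon
  rw [not_frequently, eventually_atTop] at hcon
  obtain ⟨k0, hk0⟩ := hcon
  have hM1 : ∀ k, (1:ℝ) ≤ covNum 2 k K := fun k => by
    have : 0 < covNum 2 k K := by
      rw [covNum_eq, Set.ncard_pos (cubesOf_finite k K hb), cubesOf_eq]
      exact hne.image _
    exact_mod_cast this
  set L : ℝ := ((2:ℝ)^k0)^t with hL
  have hL1 : 1 ≤ L := Real.one_le_rpow (one_le_pow₀ (by norm_num)) ht.le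
  have hM : ∀ j, ((2:ℝ)^j)^t ≤ L * covNum 2 j K := fun j => by
    rcases le_total k0 j with h | h
    · have h1 := hk0 j h
      rw [not_le] at h1
      nlinarith [hM1 j]
    · calc ((2:ℝ)^j)^t ≤ L := by
            apply Real.rpow_le_rpow (by positivity) _ ht.le
            exact pow_le_pow_right₀ (by norm_num) h
        _ ≤ _ := by nlinarith [hM1 j]
  obtain ⟨I, x, j, hcov, hsum⟩ := exists_cover K hK t ht h0 (1 / (50 * C * L)) (by positivity)
  set k := I.sup j with hk
  have hjk : ∀ i ∈ I, j i ≤ k := fun i hi => Finset.le_sup hi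
  let N : ℕ → Finset (Fin 2 → ℤ) := fun i =>
    Finset.Icc (fun l => cidx (j i) (x i) l - (((1:ℕ):ℤ)+1)) (fun l => cidx (j i) (x i) l + (((1:ℕ):ℤ)+1))
  have hsubset : cubesOf k K ⊆ ⋃ i ∈ I, ⋃ m ∈ N i, cubesOf k (K ∩ dyadicCube 2 (j i) m) := by
    rw [cubesOf_eq]
    rintro _ ⟨y, hy, rfl⟩
    obtain ⟨i, hi, hyi⟩ := Set.mem_iUnion₂.1 (hcov hy)
    refine Set.mem_iUnion₂.2 ⟨i, hi, Set.mem_iUnion₂.2 ⟨cidx (j i) y, ?_, ?_⟩⟩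
    · apply cidx_near
      intro l
      have := abs_coord_le y (x i) l
      have h2 := Metric.mem_ball.1 hyi
      push_cast
      linarith
    · rw [cubesOf_eq]
      exact ⟨y, ⟨hy, (mem_cube_iff _ _ _).2 rfl⟩, rfl⟩
  have hcount : (covNum 2 k K : ℝ) ≤ ∑ i ∈ I, ∑ m ∈ N i, (covNum 2 k (K ∩ dyadicCube 2 (j i) m) : ℝ) := by
    have hf : ∀ i m, (cubesOf k (K ∩ dyadicCube 2 (j i) m)).Finite := fun i m =>
      cubesOf_finite k _ (hb.subset Set.inter_subset_left)
    have h1 : (cubesOf k K).ncard ≤ (⋃ i ∈ I, ⋃ m ∈ N i, cubesOf k (K ∩ dyadicCube 2 (j i) m)).ncard := by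
      refine Set.ncard_le_ncard hsubset ?_
      exact I.finite_toSet.biUnion fun i _ => (N i).finite_toSet.biUnion fun m _ => hf i m
    have h2 := h1.trans ((Finset.set_ncard_biUnion_le I _).trans
      (Finset.sum_le_sum fun i _ => Finset.set_ncard_biUnion_le (N i) _))
    simp only [covNum_eq]
    exact_mod_cast h2
  have hterm : ∀ i ∈ I, ∀ m ∈ N i, (covNum 2 k (K ∩ dyadicCube 2 (j i) m) : ℝ) ≤
      C * L * covNum 2 k K * ((1/2:ℝ)^(j i))^t := by
    intro i hi m _
    by_cases hne : (dyadicCube 2 (j i) m ∩ K).Nonempty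
    · have h1 := hs (j i) k (hjk i hi) m hne
      have h2 := hM (j i)
      have h3 : ((1/2:ℝ)^(j i))^t * ((2:ℝ)^(j i))^t = 1 := by
        rw [← Real.mul_rpow (by positivity) (by positivity), ← mul_pow]; norm_num
      set a := ((1/2:ℝ)^(j i))^t
      have ha : 0 ≤ a := by positivity
      set q := (covNum 2 k (K ∩ dyadicCube 2 (j i) m) : ℝ)
      have hq : 0 ≤ q := by positivity
      calc q = q * (a * ((2:ℝ)^(j i))^t) := by rw [h3, mul_one]
        _ ≤ q * (a * (L * covNum 2 (j i) K)) := by gcongr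
        _ = a * L * (covNum 2 (j i) K * q) := by ring
        _ ≤ a * L * (C * covNum 2 k K) := by gcongr
        _ = _ := by ring
    · have : covNum 2 k (K ∩ dyadicCube 2 (j i) m) = 0 := by
        rw [Set.not_nonempty_iff_eq_empty, Set.inter_comm] at hne
        rw [covNum_eq, cubesOf_eq, hne]; simp
      rw [this]; push_cast; positivity
  have hfinal : (covNum 2 k K : ℝ) ≤ 25 * (C * L * covNum 2 k K) * (1 / (50 * C * L)) := by
    calc (covNum 2 k K : ℝ) ≤ ∑ i ∈ I, ∑ m ∈ N i, (covNum 2 k (K ∩ dyadicCube 2 (j i) m) : ℝ) := hcount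
      _ ≤ ∑ i ∈ I, ∑ m ∈ N i, C * L * covNum 2 k K * ((1/2:ℝ)^(j i))^t :=
        Finset.sum_le_sum fun i hi => Finset.sum_le_sum fun m hm => hterm i hi m hm
      _ = 25 * (C * L * covNum 2 k K) * ∑ i ∈ I, ((1/2:ℝ)^(j i))^t := by
        rw [Finset.mul_sum]
        apply Finset.sum_congr rfl
        intro i _
        rw [Finset.sum_const, card_near]; norm_num; ring
      _ ≤ _ := by gcongr
  have h4 : 25 * (C * L * covNum 2 k K) * (1 / (50 * C * L)) = (covNum 2 k K : ℝ) / 2 := by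
    field_simp; ring
  rw [h4] at hfinal
  linarith [hM1 k]

lemma ediam_cube_le (j : ℕ) (m : Fin 2 → ℤ) :
    ediam (dyadicCube 2 j m) ≤ ENNReal.ofReal (2 * (1/2:ℝ)^j) := by
  apply Metric.ediam_le
  intro x hx y hy
  rw [edist_dist]
  apply ENNReal.ofReal_le_ofReal
  have h : ∀ i, |x i - y i| ≤ (1/2:ℝ)^j := by
    intro i
    have h1 := hx i
    have h2 := hy i
    have e : (2:ℝ)^(-(j:ℤ)) = (1/2:ℝ)^j := by
      rw [zpow_neg, zpow_natCast, one_div, inv_pow]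
    rw [e] at h1 h2
    rw [abs_le]; constructor <;> nlinarith
  have hp : (0:ℝ) < (1/2:ℝ)^j := by positivity
  rw [EuclideanSpace.dist_eq, Fin.sum_univ_two, Real.sqrt_le_left (by positivity)]
  simp only [Real.dist_eq]
  nlinarith [h 0, h 1, abs_nonneg (x 0 - y 0), abs_nonneg (x 1 - y 1)]

/-- `A` has dyadic `s`-content at least `c`. -/
def HasContent (s c : ℝ) (A : Set Plane) : Prop :=
  ∀ F : Finset (ℕ × (Fin 2 → ℤ)), A ⊆ ⋃ f ∈ F, dyadicCube 2 f.1 f.2 →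
    c ≤ ∑ f ∈ F, ((1/2:ℝ)^f.1)^s

open Filter Topology in
lemma exists_content (A : Set Plane) (s : ℝ) (hs : 0 < s) (h : μH[s] A ≠ 0) :
    ∃ n : ℕ, HasContent s (1 / ((n:ℝ)+1)) A := by
  by_contra hcon
  simp only [HasContent] at hcon
  push Not at hcon
  choose F hF hsum using hcon
  apply h
  have hlt : ∀ n, ∀ f ∈ F n, ((1/2:ℝ)^f.1)^s ≤ 1 / ((n:ℝ)+1) := fun n f hf =>
    (Finset.single_le_sum (f := fun f : ℕ × (Fin 2 → ℤ) => ((1/2:ℝ)^f.1)^s)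
      (fun _ _ => by positivity) hf).trans (hsum n).le
  have hlt' : ∀ n, ∀ f ∈ F n, (1/2:ℝ)^f.1 ≤ (1 / ((n:ℝ)+1))^(1/s) := fun n f hf => by
    have := Real.rpow_le_rpow (by positivity) (hlt n f hf) (by positivity : 0 ≤ 1/s)
    rwa [← Real.rpow_mul (by positivity), mul_one_div_cancel hs.ne', Real.rpow_one] at this
  have ht0 : Tendsto (fun n : ℕ => 1 / ((n:ℝ)+1)) atTop (𝓝 0) := tendsto_one_div_add_atTop_nhds_zero_nat
  have ht1 : Tendsto (fun n : ℕ => ENNReal.ofReal (2 * (1 / ((n:ℝ)+1))^(1/s))) atTop (𝓝 0) := by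
    rw [← ENNReal.ofReal_zero]
    apply ENNReal.tendsto_ofReal
    have := (ht0.rpow_const (p := 1/s) (Or.inr (by positivity))).const_mul 2
    rwa [Real.zero_rpow (by positivity), mul_zero] at this
  have ht2 : Tendsto (fun n : ℕ => ENNReal.ofReal (2^s * (1 / ((n:ℝ)+1)))) atTop (𝓝 0) := by
    rw [← ENNReal.ofReal_zero]
    apply ENNReal.tendsto_ofReal
    simpa using ht0.const_mul (2^s)
  have key := Measure.hausdorffMeasure_le_liminf_sum (ι := fun n => F n) s A (l := atTop)
    (fun n : ℕ => ENNReal.ofReal (2 * (1 / ((n:ℝ)+1))^(1/s))) ht1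
    (fun n f => dyadicCube 2 f.1.1 f.1.2)
    (Eventually.of_forall fun n f => (ediam_cube_le _ _).trans (ENNReal.ofReal_le_ofReal
      (by have := hlt' n f.1 f.2; linarith)))
    (Eventually.of_forall fun n => (hF n).trans (by
      intro y hy
      obtain ⟨f, hf, hy⟩ := Set.mem_iUnion₂.1 hy
      exact Set.mem_iUnion.2 ⟨⟨f, hf⟩, hy⟩))
  refine le_antisymm (key.trans ?_) (zero_le)
  rw [← ht2.liminf_eq]
  refine liminf_le_liminf (Eventually.of_forall fun n => ?_)
  calc _ ≤ ∑ f : F n, ENNReal.ofReal ((2 * (1/2:ℝ)^f.1.1)^s) := by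
        apply Finset.sum_le_sum
        intro f _
        rw [← ENNReal.ofReal_rpow_of_nonneg (by positivity) hs.le]
        exact ENNReal.rpow_le_rpow (ediam_cube_le _ _) hs.le
    _ = ENNReal.ofReal (∑ f ∈ F n, (2 * (1/2:ℝ)^f.1)^s) := by
        rw [ENNReal.ofReal_sum_of_nonneg (fun _ _ => by positivity)]
        exact Finset.sum_coe_sort (F n) (fun f => ENNReal.ofReal ((2 * (1/2:ℝ)^f.1)^s))
    _ ≤ _ := by
        apply ENNReal.ofReal_le_ofReal
        have : ∀ f ∈ F n, (2 * (1/2:ℝ)^f.1)^s = 2^s * ((1/2:ℝ)^f.1)^s := fun f _ =>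
          Real.mul_rpow (by norm_num) (by positivity)
        rw [Finset.sum_congr rfl this, ← Finset.mul_sum]
        gcongr
        exact (hsum n).le

lemma tree_frostman {X : Type*} [DecidableEq X] (S : Finset X) (k : ℕ) (a : ℕ → X → X)
    (ha : ∀ j j', j ≤ j' → j' ≤ k → ∀ x y, a j' x = a j' y → a j x = a j y)
    (hak : ∀ x, a k x = x) (b : ℕ → ℝ) (hb : ∀ j, 0 ≤ b j) :
    ∃ w : X → ℝ, (∀ x, 0 ≤ w x) ∧ (∀ x, x ∉ S → w x = 0) ∧
      (∀ j ≤ k, ∀ y, ∑ x ∈ S with a j x = y, w x ≤ b j) ∧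
      ∃ F : Finset (ℕ × X), (∀ x ∈ S, ∃ f ∈ F, f.1 ≤ k ∧ a f.1 x = f.2) ∧
        ∑ f ∈ F, b f.1 ≤ ∑ x ∈ S, w x := by
  classical
  set P : Set (X → ℝ) := Set.pi Set.univ (fun x => if x ∈ S then Set.Icc 0 (b k) else {0}) with hP
  have hPc : IsCompact P := by
    apply isCompact_univ_pi
    intro x
    split_ifs
    · exact isCompact_Icc
    · exact isCompact_singleton
  set W : Set (X → ℝ) := P ∩ {w | ∀ j ≤ k, ∀ y, ∑ x ∈ S with a j x = y, w x ≤ b j} with hW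
  have hWc : IsCompact W := by
    apply hPc.inter_right
    have : {w : X → ℝ | ∀ j ≤ k, ∀ y, ∑ x ∈ S with a j x = y, w x ≤ b j} =
      ⋂ j, ⋂ (_ : j ≤ k), ⋂ y, {w | ∑ x ∈ S with a j x = y, w x ≤ b j} := by
      ext w; simp
    rw [this]
    refine isClosed_iInter fun j => isClosed_iInter fun _ => isClosed_iInter fun y => ?_
    exact isClosed_le (continuous_finsetSum _ fun x _ => continuous_apply x) continuous_const
  have hW0 : W.Nonempty := by
    refine ⟨0, ?_, ?_⟩
    · intro x _
      simp only [Pi.zero_apply]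
      split_ifs
      · exact ⟨le_rfl, hb k⟩
      · rfl
    · intro j _ y
      simpa using hb j
  obtain ⟨w, hw, hmax⟩ := hWc.exists_isMaxOn hW0
    (f := fun w : X → ℝ => ∑ x ∈ S, w x) (continuous_finsetSum _ fun x _ => continuous_apply x).continuousOn
  have hmem : ∀ x ∈ S, 0 ≤ w x := fun x hx => by
    have := hw.1 x trivial
    simp only [hx, if_true] at this
    exact this.1
  have hsupp : ∀ x, x ∉ S → w x = 0 := fun x hx => by
    have := hw.1 x trivial
    simpa [hx] using this
  have hw0 : ∀ x, 0 ≤ w x := fun x => by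
    by_cases h : x ∈ S
    · exact hmem x h
    · rw [hsupp x h]
  have hsat : ∀ x ∈ S, ∃ j, j ≤ k ∧ ∑ x' ∈ S with a j x' = a j x, w x' = b j := by
    intro x hx
    by_contra hcon
    push Not at hcon
    have hlt : ∀ j ≤ k, 0 < b j - ∑ x' ∈ S with a j x' = a j x, w x' := fun j hj =>
      sub_pos.2 (lt_of_le_of_ne (hw.2 j hj _) (hcon j hj))
    obtain ⟨j0, hj0, hmin⟩ := Finset.exists_min_image (Finset.range (k+1))
      (fun j => b j - ∑ x' ∈ S with a j x' = a j x, w x') ⟨0, by simp⟩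
    set ε := b j0 - ∑ x' ∈ S with a j0 x' = a j0 x, w x' with hε
    have hε0 : 0 < ε := hlt j0 (by simpa [Nat.lt_succ_iff] using hj0)
    have hsum1 : ∀ T : Finset X, ∑ x' ∈ T, (w x' + if x' = x then ε else 0)
        = ∑ x' ∈ T, w x' + if x ∈ T then ε else 0 := by
      intro T
      rw [Finset.sum_add_distrib, Finset.sum_ite_eq']
    have hle : ∀ j ≤ k, ∀ y, ∑ x' ∈ S with a j x' = y, (w x' + if x' = x then ε else 0) ≤ b j := by
      intro j hj y
      rw [hsum1]
      by_cases h : a j x = y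
      · subst h
        have := hmin j (by simpa [Nat.lt_succ_iff] using hj)
        simp only [Finset.mem_filter, hx, true_and, if_true]
        linarith
      · simp only [Finset.mem_filter, h, and_false, if_false, add_zero]
        exact hw.2 j hj y
    have hin : (fun x' => w x' + if x' = x then ε else 0) ∈ W := by
      refine ⟨?_, hle⟩
      intro y _
      by_cases hy : y ∈ S
      · simp only [hy, if_true]
        constructor
        · have := hw0 y
          split_ifs <;> linarith
        · have := hle k le_rfl y
          simp only [hak] at this
          rw [Finset.filter_eq' S y, if_pos hy, Finset.sum_singleton] at this
          exact this
      · have hyx : y ≠ x := fun h => hy (h ▸ hx)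
        simp [hy, hyx, hsupp y hy]
    have := hmax hin
    simp only [Set.mem_ofPred_eq] at this
    rw [hsum1, if_pos hx] at this
    linarith
  refine ⟨w, hw0, hsupp, hw.2, ?_⟩
  -- least saturated level
  let J : X → ℕ := fun x => if h : ∃ j, j ≤ k ∧ ∑ x' ∈ S with a j x' = a j x, w x' = b j
    then Nat.find h else 0
  have hJ : ∀ x ∈ S, J x ≤ k ∧ ∑ x' ∈ S with a (J x) x' = a (J x) x, w x' = b (J x) := by
    intro x hx
    have h := hsat x hx
    simp only [J, dif_pos h]
    exact Nat.find_spec h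
  have hJmin : ∀ x, ∀ j ≤ k, ∑ x' ∈ S with a j x' = a j x, w x' = b j → J x ≤ j := by
    intro x j hj hjs
    have h : ∃ j, j ≤ k ∧ ∑ x' ∈ S with a j x' = a j x, w x' = b j := ⟨j, hj, hjs⟩
    simp only [J, dif_pos h]
    exact Nat.find_min' h ⟨hj, hjs⟩
  let φ : X → ℕ × X := fun x => (J x, a (J x) x)
  have hφ : ∀ x ∈ S, ∀ y ∈ S, a (J x) y = a (J x) x → φ y = φ x := by
    intro x hx y hy h
    have h1 : J y ≤ J x := by
      apply hJmin y _ (hJ x hx).1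
      rw [h]; exact (hJ x hx).2
    have h2 : a (J y) y = a (J y) x := ha _ _ h1 (hJ x hx).1 _ _ h
    have h3 : J x ≤ J y := by
      apply hJmin x _ (hJ y hy).1
      rw [← h2]; exact (hJ y hy).2
    have h4 : J y = J x := le_antisymm h1 h3
    simp only [φ, h4, h]
  refine ⟨S.image φ, fun x hx => ⟨φ x, Finset.mem_image_of_mem _ hx, (hJ x hx).1, rfl⟩, ?_⟩
  rw [← Finset.sum_fiberwise_of_maps_to (s := S) (t := S.image φ) (g := φ)
    (fun x hx => Finset.mem_image_of_mem _ hx)]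
  apply Finset.sum_le_sum
  intro f hf
  obtain ⟨x, hx, rfl⟩ := Finset.mem_image.1 hf
  have := (hJ x hx).2
  change b (J x) ≤ _
  rw [← this]
  apply Finset.sum_le_sum_of_subset_of_nonneg
  · intro y hy
    rw [Finset.mem_filter] at hy ⊢
    exact ⟨hy.1, hφ x hx y hy.1 hy.2⟩
  · intro y _ _; exact hw0 y

/-- level-`j` ancestor of a level `k` index -/
def anc (k j : ℕ) (m : Fin 2 → ℤ) : Fin 2 → ℤ := fun i => m i / ((2 ^ (k - j) : ℕ) : ℤ)

lemma anc_cidx (k j : ℕ) (h : j ≤ k) (x : Plane) : anc k j (cidx k x) = cidx j x := by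
  funext i; exact (cidx_anc j k h x i).symm

lemma frostman (S : Finset (Fin 2 → ℤ)) (A : Set Plane) (s c : ℝ) (hA : HasContent s c A)
    (k : ℕ) (hS : cubesOf k A = ↑S) :
    ∃ w : (Fin 2 → ℤ) → ℝ, (∀ m, 0 ≤ w m) ∧ (∀ m, m ∉ S → w m = 0) ∧ c ≤ ∑ m ∈ S, w m ∧
      ∀ j ≤ k, ∀ m', ∑ m ∈ S with anc k j m = m', w m ≤ ((1/2:ℝ)^j)^s := by
  obtain ⟨w, h0, hsupp, hle, F, hF, hsum⟩ := tree_frostman S k (anc k) (by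
    intro j j' hj hj' x y h
    funext i
    have h1 := congrFun h i
    simp only [anc] at h1 ⊢
    have e : k - j = (k - j') + (j' - j) := by omega
    rw [e, pow_add]
    push_cast at h1 ⊢
    rw [← Int.ediv_ediv_of_nonneg (by positivity), ← Int.ediv_ediv_of_nonneg (by positivity), h1])
    (by intro x; funext i; simp [anc]) (fun j => ((1/2:ℝ)^j)^s) (fun j => by positivity)
  refine ⟨w, h0, hsupp, (hA F ?_).trans hsum, hle⟩
  intro x hx
  have : cidx k x ∈ S := by
    rw [← Finset.mem_coe, ← hS, cubesOf_eq]
    exact ⟨x, hx, rfl⟩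
  obtain ⟨f, hf, hfk, hfx⟩ := hF _ this
  refine Set.mem_iUnion₂.2 ⟨f, hf, ?_⟩
  rw [mem_cube_iff, ← anc_cidx k f.1 hfk, hfx]

lemma sum_rpow_le (s : ℝ) (hs0 : 0 < s) (hs1 : s < 1) (N : ℕ) :
    ∑ d ∈ Finset.range N, ((d:ℝ)+1)^(-s) ≤ (N:ℝ)^(1-s) / (1-s) := by
  have hs : 0 < 1 - s := by linarith
  induction N with
  | zero => simp [Real.zero_rpow hs.ne']
  | succ N ih =>
    rw [Finset.sum_range_succ]
    push_cast
    have hN : (0:ℝ) < (N:ℝ) + 1 := by positivity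
    have hb := rpow_one_add_le_one_add_mul_self (s := -1/((N:ℝ)+1)) (p := 1 - s)
      (by rw [le_div_iff₀ hN]; linarith [(Nat.cast_nonneg N : (0:ℝ) ≤ N)]) hs.le (by linarith)
    have e1 : 1 + -1/((N:ℝ)+1) = N/((N:ℝ)+1) := by field_simp; ring
    rw [e1, Real.div_rpow (by positivity) hN.le, div_le_iff₀ (by positivity)] at hb
    have e2 : ((N:ℝ)+1)^(1-s) = ((N:ℝ)+1) * ((N:ℝ)+1)^(-s) := by
      rw [sub_eq_add_neg, Real.rpow_add hN, Real.rpow_one]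
    have e3 : (1 + (1 - s) * (-1/((N:ℝ)+1))) * ((N:ℝ)+1)^(1-s)
        = ((N:ℝ)+1)^(1-s) - (1-s) * ((N:ℝ)+1)^(-s) := by
      rw [e2]; field_simp; ring
    rw [e3] at hb
    rw [le_div_iff₀ hs] at ih ⊢
    nlinarith

lemma sum_J_le (s : ℝ) (hs0 : 0 < s) (hs1 : s < 1) (k : ℕ) (J : Finset ℤ)
    (hJ : J ⊆ Finset.Icc (-2^k) (2^k)) (n : ℤ) (hn : n ∈ J) :
    ∑ m ∈ J, ((max (n - m).natAbs 1 : ℕ) : ℝ)^(-s) ≤ (2 * (1 + 2 / (1-s))) * ((2:ℝ)^k)^(1-s) := by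
  have hs : 0 < 1 - s := by linarith
  have hmaps : ∀ m ∈ J, (n - m).natAbs ∈ Finset.range (2^(k+1) + 1) := by
    intro m hm
    have h1 := Finset.mem_Icc.1 (hJ hm)
    have h2 := Finset.mem_Icc.1 (hJ hn)
    rw [Finset.mem_range, pow_succ]
    have : ((2^k : ℕ) : ℤ) = 2^k := by push_cast; rfl
    omega
  have hone : (1:ℝ) ≤ ((2:ℝ)^k)^(1-s) := Real.one_le_rpow (one_le_pow₀ (by norm_num)) hs.le
  rw [← Finset.sum_fiberwise_of_maps_to hmaps]
  calc _ ≤ ∑ d ∈ Finset.range (2^(k+1)+1), 2 * ((max d 1 : ℕ):ℝ)^(-s) := by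
        apply Finset.sum_le_sum
        intro d _
        have : ∀ m ∈ J.filter (fun m => (n - m).natAbs = d),
            ((max (n - m).natAbs 1 : ℕ) : ℝ)^(-s) = ((max d 1 : ℕ):ℝ)^(-s) := by
          intro m hm
          rw [(Finset.mem_filter.1 hm).2]
        rw [Finset.sum_congr rfl this, Finset.sum_const, nsmul_eq_mul]
        gcongr
        have hsubs : J.filter (fun m => (n - m).natAbs = d) ⊆ {n - d, n + d} := by
          intro m hm
          have := (Finset.mem_filter.1 hm).2
          simp only [Finset.mem_insert, Finset.mem_singleton]
          omega
        exact_mod_cast (Finset.card_le_card hsubs).trans Finset.card_le_two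
    _ = 2 * (1 + ∑ d ∈ Finset.range (2^(k+1)), ((d:ℝ)+1)^(-s)) := by
        rw [← Finset.mul_sum, Finset.sum_range_succ', add_comm]
        simp
    _ ≤ 2 * (1 + ((2^(k+1) : ℕ):ℝ)^(1-s) / (1-s)) := by
        gcongr
        exact sum_rpow_le s hs0 hs1 _
    _ ≤ 2 * (1 + 2 * ((2:ℝ)^k)^(1-s) / (1-s)) := by
        gcongr
        push_cast
        rw [pow_succ, Real.mul_rpow (by positivity) (by norm_num), mul_comm]
        gcongr
        calc (2:ℝ)^(1-s) ≤ 2^(1:ℝ) := Real.rpow_le_rpow_of_exponent_le (by norm_num) (by linarith)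
          _ = 2 := by simp
    _ ≤ _ := by
        have : (2 * (1 + 2 / (1-s))) * ((2:ℝ)^k)^(1-s) = 2 * (((2:ℝ)^k)^(1-s) + 2 * ((2:ℝ)^k)^(1-s) / (1-s)) := by ring
        rw [this]
        gcongr

/-- the wedge of two vectors -/
def wedge (e f : Plane) : ℝ := e 0 * f 1 - e 1 * f 0

lemma circle_eq {e : Plane} (he : e ∈ unitCircle) : e 0 ^ 2 + e 1 ^ 2 = 1 := by
  have h : ‖e‖ = 1 := by simpa [unitCircle] using he
  have := EuclideanSpace.norm_sq_eq e
  rw [h, Fin.sum_univ_two] at this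
  simp at this
  linarith

lemma coord_le_one {e : Plane} (he : e ∈ unitCircle) (i : Fin 2) : |e i| ≤ 1 := by
  have := circle_eq he
  rw [abs_le_one_iff_mul_self_le_one]
  fin_cases i <;> simp <;> nlinarith [sq_nonneg (e 0), sq_nonneg (e 1)]

lemma line_inter {e f z y p q p' q' : Plane} {r : ℝ} (he : e ∈ unitCircle) (hf : f ∈ unitCircle)
    (hp : p ∈ lineThrough e z) (hq : q ∈ lineThrough e z)
    (hp' : p' ∈ lineThrough f y) (hq' : q' ∈ lineThrough f y)
    (h1 : ∀ i, |p i - p' i| ≤ r) (h2 : ∀ i, |q i - q' i| ≤ r) (i : Fin 2) :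
    |q i - p i| * |wedge e f| ≤ 4 * r := by
  obtain ⟨a, rfl⟩ := hp
  obtain ⟨b, rfl⟩ := hq
  obtain ⟨a', rfl⟩ := hp'
  obtain ⟨b', rfl⟩ := hq'
  simp only [PiLp.add_apply, PiLp.smul_apply, smul_eq_mul] at h1 h2 ⊢
  have hr : 0 ≤ r := (abs_nonneg _).trans (h1 0)
  have hv : ∀ i, |(b - a) * e i - (b' - a') * f i| ≤ 2 * r := fun i => by
    have := abs_sub (z i + b * e i - (y i + b' * f i)) (z i + a * e i - (y i + a' * f i))
    have e1 : (b - a) * e i - (b' - a') * f i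
      = (z i + b * e i - (y i + b' * f i)) - (z i + a * e i - (y i + a' * f i)) := by ring
    rw [e1]
    linarith [h1 i, h2 i]
  have hw : (b - a) * wedge e f = ((b - a) * e 0 - (b' - a') * f 0) * f 1
      - ((b - a) * e 1 - (b' - a') * f 1) * f 0 := by
    simp only [wedge]; ring
  have hX : |b - a| * |wedge e f| ≤ 4 * r := by
    rw [← abs_mul, hw]
    refine (abs_sub _ _).trans ?_
    rw [abs_mul, abs_mul]
    have g1 := mul_le_mul (hv 0) (coord_le_one hf 1) (abs_nonneg _) (by positivity)
    have g2 := mul_le_mul (hv 1) (coord_le_one hf 0) (abs_nonneg _) (by positivity)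
    linarith
  have e2 : z i + b * e i - (z i + a * e i) = (b - a) * e i := by ring
  rw [e2, abs_mul]
  calc |b - a| * |e i| * |wedge e f| ≤ |b - a| * 1 * |wedge e f| := by
        gcongr; exact coord_le_one he i
    _ ≤ _ := by simpa using hX

lemma same_cube {k : ℕ} {x y : Plane} (h : cidx k x = cidx k y) (i : Fin 2) :
    |x i - y i| ≤ (1/2:ℝ)^k := by
  have h1 := congrFun h i
  simp only [cidx] at h1
  have h2 := (Int.abs_sub_lt_one_of_floor_eq_floor h1).le
  rw [← sub_mul, abs_mul, abs_of_pos (by positivity : (0:ℝ) < 2^k)] at h2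
  rw [one_div, inv_pow, ← one_div, le_div_iff₀ (by positivity)]
  exact h2

lemma cross_mass {K : Set Plane} {e f z y : Plane} (he : e ∈ unitCircle) (hf : f ∈ unitCircle)
    {k j : ℕ} (hj : j ≤ k) {s : ℝ} {S T : Finset (Fin 2 → ℤ)}
    (hS : cubesOf k (K ∩ lineThrough e z) = ↑S) (hT : cubesOf k (K ∩ lineThrough f y) = ↑T)
    {w : (Fin 2 → ℤ) → ℝ} (hw0 : ∀ m, 0 ≤ w m)
    (hw : ∀ m', ∑ m ∈ S with anc k j m = m', w m ≤ ((1/2:ℝ)^j)^s)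
    (hX : 4 * (1/2:ℝ)^k ≤ 8 * (1/2:ℝ)^j * |wedge e f|) :
    ∑ m ∈ S ∩ T, w m ≤ 361 * ((1/2:ℝ)^j)^s := by
  classical
  rcases (S ∩ T).eq_empty_or_nonempty with h | ⟨m0, hm0⟩
  · rw [h]; simp; positivity
  have hpt : ∀ m ∈ S ∩ T, ∃ q q' : Plane, q ∈ lineThrough e z ∧ q' ∈ lineThrough f y ∧
      cidx k q = m ∧ cidx k q' = m := by
    intro m hm
    rw [Finset.mem_inter, ← Finset.mem_coe, ← Finset.mem_coe, ← hS, ← hT, cubesOf_eq, cubesOf_eq] at hm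
    obtain ⟨⟨q, hq, h1⟩, ⟨q', hq', h2⟩⟩ := hm
    exact ⟨q, q', hq.2, hq'.2, h1, h2⟩
  obtain ⟨p, p', hp, hp', hpm, hpm'⟩ := hpt m0 hm0
  have hXpos : 0 < |wedge e f| := by
    by_contra hcon
    have : |wedge e f| = 0 := le_antisymm (not_lt.1 hcon) (abs_nonneg _)
    rw [this, mul_zero] at hX
    have : (0:ℝ) < (1/2:ℝ)^k := by positivity
    linarith
  have hmaps : ∀ m ∈ S ∩ T, anc k j m ∈ Finset.Icc (fun i => cidx j p i - (((8:ℕ):ℤ)+1))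
      (fun i => cidx j p i + (((8:ℕ):ℤ)+1)) := by
    intro m hm
    obtain ⟨q, q', hq, hq', hqm, hqm'⟩ := hpt m hm
    rw [← hqm, anc_cidx k j hj]
    apply cidx_near
    intro i
    have := line_inter he hf hp hq hp' hq' (fun i => same_cube (hpm.trans hpm'.symm) i)
      (fun i => same_cube (hqm.trans hqm'.symm) i) i
    have h3 := this.trans hX
    push_cast
    exact le_of_mul_le_mul_right h3 hXpos
  rw [← Finset.sum_fiberwise_of_maps_to hmaps]
  calc _ ≤ ∑ m' ∈ (Finset.Icc (fun i => cidx j p i - (((8:ℕ):ℤ)+1))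
            (fun i => cidx j p i + (((8:ℕ):ℤ)+1))), ((1/2:ℝ)^j)^s := by
        apply Finset.sum_le_sum
        intro m' _
        refine le_trans ?_ (hw m')
        apply Finset.sum_le_sum_of_subset_of_nonneg
        · intro m hm
          rw [Finset.mem_filter] at hm ⊢
          exact ⟨Finset.mem_of_mem_inter_left hm.1, hm.2⟩
        · intro m _ _; exact hw0 m
    _ = _ := by rw [Finset.sum_const, card_near]; norm_num

lemma total_mass {K A : Set Plane} (hb : Bornology.IsBounded K) (hAK : A ⊆ K)
    {k : ℕ} {s : ℝ} {S : Finset (Fin 2 → ℤ)} (hS : cubesOf k A = ↑S)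
    {w : (Fin 2 → ℤ) → ℝ}
    (hw : ∀ m', ∑ m ∈ S with anc k 0 m = m', w m ≤ ((1/2:ℝ)^0)^s) :
    ∑ m ∈ S, w m ≤ covNum 2 0 K := by
  classical
  have hfin := cubesOf_finite 0 K hb
  have hmaps : ∀ m ∈ S, anc k 0 m ∈ hfin.toFinset := by
    intro m hm
    rw [← Finset.mem_coe, ← hS, cubesOf_eq] at hm
    obtain ⟨q, hq, rfl⟩ := hm
    rw [anc_cidx k 0 (Nat.zero_le _), Set.Finite.mem_toFinset, cubesOf_eq]
    exact ⟨q, hAK hq, rfl⟩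
  rw [← Finset.sum_fiberwise_of_maps_to hmaps, covNum_eq, Set.ncard_eq_toFinset_card _ hfin]
  calc _ ≤ ∑ m' ∈ hfin.toFinset, (1:ℝ) := by
        apply Finset.sum_le_sum
        intro m' _
        simpa using hw m'
    _ = _ := by simp

lemma pair_bound {K : Set Plane} (hb : Bornology.IsBounded K) {e f z y : Plane}
    (he : e ∈ unitCircle) (hf : f ∈ unitCircle) {k : ℕ} {s : ℝ} (hs0 : 0 < s) (hs1 : s < 1)
    {S T : Finset (Fin 2 → ℤ)}
    (hS : cubesOf k (K ∩ lineThrough e z) = ↑S) (hT : cubesOf k (K ∩ lineThrough f y) = ↑T)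
    {w : (Fin 2 → ℤ) → ℝ} (hw0 : ∀ m, 0 ≤ w m)
    (hw : ∀ j ≤ k, ∀ m', ∑ m ∈ S with anc k j m = m', w m ≤ ((1/2:ℝ)^j)^s)
    (a b : ℝ) (hab : |a - b| ≤ 2 * |wedge e f|) (n m : ℤ) (hn : ⌊a * 2^k⌋ = n) (hm : ⌊b * 2^k⌋ = m)
    (hnm : (n - m).natAbs ≤ 2^(k+1)) :
    ∑ m ∈ S ∩ T, w m ≤ (1444 + covNum 2 0 K) * ((max (n - m).natAbs 1 : ℕ) : ℝ)^(-s) := by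
  set d := (n - m).natAbs with hd
  have hM0 : (0:ℝ) ≤ covNum 2 0 K := by positivity
  by_cases hd1 : d ≤ 1
  · rw [max_eq_right hd1]
    simp only [Nat.cast_one, Real.one_rpow, mul_one]
    have h1 : ∑ m ∈ S ∩ T, w m ≤ ∑ m ∈ S, w m :=
      Finset.sum_le_sum_of_subset_of_nonneg Finset.inter_subset_left (fun m _ _ => hw0 m)
    have h2 := total_mass hb Set.inter_subset_left hS (hw 0 (Nat.zero_le _))
    linarith
  · have hd2 : 2 ≤ d := by omega
    rw [max_eq_left (by omega)]
    have hdpos : (0:ℝ) < d := by positivity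
    obtain ⟨j, hj⟩ : ∃ j, Nat.log 2 d = j + 1 :=
      Nat.exists_eq_succ_of_ne_zero (Nat.log_pos (by norm_num) hd2).ne'
    have hl : 2^(j+1) ≤ d := by rw [← hj]; exact Nat.pow_log_le_self 2 (by omega)
    have hu : d < 2^(j+2) := by
      have := Nat.lt_pow_succ_log_self (b := 2) (by norm_num) d
      rwa [hj] at this
    have hjk : j ≤ k := by
      have := (Nat.pow_le_pow_iff_right (a := 2) (by norm_num)).1 (hl.trans hnm)
      omega
    have hlR : (2:ℝ)^(j+1) ≤ d := by exact_mod_cast hl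
    have huR : (d:ℝ) < 2^(j+2) := by exact_mod_cast hu
    have hdiff : (d:ℝ) - 1 ≤ |a - b| * 2^k := by
      have h1 := Int.floor_le (a * 2^k)
      have h2 := Int.lt_floor_add_one (a * 2^k)
      have h3 := Int.floor_le (b * 2^k)
      have h4 := Int.lt_floor_add_one (b * 2^k)
      rw [hn] at h1 h2
      rw [hm] at h3 h4
      have h5 : (d:ℝ) = |(n:ℝ) - m| := by
        rw [hd, Nat.cast_natAbs]; push_cast; rfl
      have h6 : |a - b| * 2^k = |a * 2^k - b * 2^k| := by
        rw [← sub_mul, abs_mul, abs_of_pos (by positivity : (0:ℝ) < 2^k)]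
      rw [h5, h6]
      rcases abs_cases ((n:ℝ) - m) with h | h <;> rcases abs_cases (a * 2^k - b * 2^k) with h' | h' <;> linarith
    have hX : (d:ℝ) / 4 * (1/2:ℝ)^k ≤ |wedge e f| := by
      have h2 : (d:ℝ) / 2 ≤ d - 1 := by
        have : (2:ℝ) ≤ d := by exact_mod_cast hd2
        linarith
      have h3 : (d:ℝ)/2 ≤ 2 * |wedge e f| * 2^k :=
        (h2.trans hdiff).trans (by gcongr)
      rw [one_div, inv_pow, ← div_eq_mul_inv, div_le_iff₀ (by positivity)]
      linarith
    have hXX : 4 * (1/2:ℝ)^k ≤ 8 * (1/2:ℝ)^j * |wedge e f| := by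
      calc 4 * (1/2:ℝ)^k = 8 * (1/2:ℝ)^j * ((2:ℝ)^(j+1) / 4 * (1/2:ℝ)^k) := by
            have : (1/2:ℝ)^j * 2^j = 1 := by rw [← mul_pow]; norm_num
            rw [pow_succ]
            linear_combination (-4 * (1/2:ℝ)^k) * this
        _ ≤ 8 * (1/2:ℝ)^j * ((d:ℝ) / 4 * (1/2:ℝ)^k) := by gcongr
        _ ≤ _ := by gcongr
    have h1 := cross_mass he hf hjk hS hT hw0 (hw j hjk) hXX
    have h2 : ((1/2:ℝ)^j)^s ≤ 4 * (d:ℝ)^(-s) := by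
      calc ((1/2:ℝ)^j)^s ≤ (4 / (d:ℝ))^s := by
            apply Real.rpow_le_rpow (by positivity) _ hs0.le
            rw [le_div_iff₀ hdpos]
            calc (1/2:ℝ)^j * d ≤ (1/2:ℝ)^j * 2^(j+2) := by gcongr
              _ = 4 := by
                have : (1/2:ℝ)^j * 2^j = 1 := by rw [← mul_pow]; norm_num
                rw [pow_add]; linear_combination 4 * this
        _ = 4^s * (d:ℝ)^(-s) := by
            rw [Real.div_rpow (by norm_num) hdpos.le, Real.rpow_neg hdpos.le, div_eq_mul_inv]
        _ ≤ _ := by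
            gcongr
            calc (4:ℝ)^s ≤ 4^(1:ℝ) := Real.rpow_le_rpow_of_exponent_le (by norm_num) hs1.le
              _ = 4 := by simp
    have h3 : 0 ≤ (covNum 2 0 K : ℝ) * (d:ℝ)^(-s) := by positivity
    rw [add_mul]
    linarith

lemma count_bound {K : Set Plane} (hb : Bornology.IsBounded K) {P : Set Plane} (u : Plane → ℝ)
    (hP : P ⊆ unitCircle) (hu2 : ∀ e ∈ P, ∀ f ∈ P, |u e - u f| ≤ 2 * |wedge e f|)
    {s c : ℝ} (hs0 : 0 < s) (hs1 : s < 1) (hc : 0 < c)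
    (hcont : ∀ e ∈ P, ∃ z, HasContent s c (K ∩ lineThrough e z))
    (k : ℕ) (J : Finset ℤ) (hJ : J ⊆ Finset.Icc (-2^k) (2^k))
    (hJP : ∀ n ∈ J, ∃ e ∈ P, ⌊u e * 2^k⌋ = n) :
    (J.card : ℝ) * c^2 ≤ covNum 2 k K * (((1/2:ℝ)^k)^s * ((1444 + covNum 2 0 K) *
      ((2 * (1 + 2 / (1-s))) * ((2:ℝ)^k)^(1-s)))) := by
  classical
  have hex : ∀ n : ℤ, ∃ (e z : Plane) (S : Finset (Fin 2 → ℤ)) (w : (Fin 2 → ℤ) → ℝ), n ∈ J →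
      (e ∈ P ∧ ⌊u e * 2^k⌋ = n ∧ cubesOf k (K ∩ lineThrough e z) = ↑S ∧ (∀ m, 0 ≤ w m) ∧
      (∀ m, m ∉ S → w m = 0) ∧ c ≤ ∑ m ∈ S, w m ∧
      ∀ j ≤ k, ∀ m', ∑ m ∈ S with anc k j m = m', w m ≤ ((1/2:ℝ)^j)^s) := by
    intro n
    by_cases hn : n ∈ J
    · obtain ⟨e, he, hen⟩ := hJP n hn
      obtain ⟨z, hz⟩ := hcont e he
      have hfin := cubesOf_finite k (K ∩ lineThrough e z) (hb.subset Set.inter_subset_left)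
      obtain ⟨w, h1, h2, h3, h4⟩ := frostman hfin.toFinset _ s c hz k (by simp)
      exact ⟨e, z, hfin.toFinset, w, fun _ => ⟨he, hen, by simp, h1, h2, h3, h4⟩⟩
    · exact ⟨0, 0, ∅, 0, fun h => absurd h hn⟩
  choose e z S w hall using hex
  have hKfin := cubesOf_finite k K hb
  set Q := hKfin.toFinset with hQ
  have hM : covNum 2 k K = Q.card := by
    rw [covNum_eq, Set.ncard_eq_toFinset_card _ hKfin]
  have hSQ : ∀ n ∈ J, S n ⊆ Q := by
    intro n hn m hm
    rw [← Finset.mem_coe, ← (hall n hn).2.2.1, cubesOf_eq] at hm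
    obtain ⟨q, hq, rfl⟩ := hm
    rw [hQ, Set.Finite.mem_toFinset, cubesOf_eq]
    exact ⟨q, hq.1, rfl⟩
  have hwmax : ∀ n ∈ J, ∀ m ∈ S n, w n m ≤ ((1/2:ℝ)^k)^s := by
    intro n hn m hm
    have h := (hall n hn).2.2.2.2.2.2 k le_rfl m
    have hanc : ∀ m, anc k k m = m := fun m => by funext i; simp [anc]
    simp only [hanc] at h
    rwa [Finset.filter_eq' (S n) m, if_pos hm, Finset.sum_singleton] at h
  have hpair : ∀ n ∈ J, ∀ n' ∈ J, ∑ m ∈ Q, w n m * w n' m ≤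
      ((1/2:ℝ)^k)^s * ((1444 + covNum 2 0 K) * ((max (n - n').natAbs 1 : ℕ) : ℝ)^(-s)) := by
    intro n hn n' hn'
    obtain ⟨a1, a2, a3, a4, a5, a6, a7⟩ := hall n hn
    obtain ⟨b1, b2, b3, b4, b5, b6, b7⟩ := hall n' hn'
    have h1 : ∑ m ∈ Q, w n m * w n' m = ∑ m ∈ S n ∩ S n', w n m * w n' m := by
      symm
      apply Finset.sum_subset (Finset.inter_subset_left.trans (hSQ n hn))
      intro m _ hm
      rw [Finset.mem_inter, not_and_or] at hm
      rcases hm with hm | hm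
      · rw [a5 m hm, zero_mul]
      · rw [b5 m hm, mul_zero]
    rw [h1]
    have hle : (n - n').natAbs ≤ 2^(k+1) := by
      have h1 := Finset.mem_Icc.1 (hJ hn)
      have h2 := Finset.mem_Icc.1 (hJ hn')
      rw [pow_succ]
      have : ((2^k : ℕ) : ℤ) = 2^k := by push_cast; rfl
      omega
    have h2 := pair_bound hb (hP a1) (hP b1) hs0 hs1 a3 b3 a4 a7 (u (e n)) (u (e n'))
      (hu2 _ a1 _ b1) n n' a2 b2 hle
    calc _ ≤ ∑ m ∈ S n ∩ S n', ((1/2:ℝ)^k)^s * w n m := by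
          apply Finset.sum_le_sum
          intro m hm
          rw [mul_comm]
          exact mul_le_mul_of_nonneg_right (hwmax n' hn' m (Finset.mem_of_mem_inter_right hm)) (a4 m)
      _ = ((1/2:ℝ)^k)^s * ∑ m ∈ S n ∩ S n', w n m := by rw [Finset.mul_sum]
      _ ≤ _ := by gcongr
  set R : ℝ := ((1/2:ℝ)^k)^s * ((1444 + covNum 2 0 K) *
      ((2 * (1 + 2 / (1-s))) * ((2:ℝ)^k)^(1-s))) with hR
  have hL2 : ∑ m ∈ Q, (∑ n ∈ J, w n m)^2 ≤ J.card * R := by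
    calc ∑ m ∈ Q, (∑ n ∈ J, w n m)^2 = ∑ n ∈ J, ∑ n' ∈ J, ∑ m ∈ Q, w n m * w n' m := by
          simp_rw [sq, Finset.sum_mul_sum]
          rw [Finset.sum_comm]
          apply Finset.sum_congr rfl
          intro n _
          rw [Finset.sum_comm]
      _ ≤ ∑ n ∈ J, ∑ n' ∈ J, ((1/2:ℝ)^k)^s * ((1444 + covNum 2 0 K) * ((max (n - n').natAbs 1 : ℕ) : ℝ)^(-s)) :=
          Finset.sum_le_sum fun n hn => Finset.sum_le_sum fun n' hn' => hpair n hn n' hn'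
      _ ≤ ∑ n ∈ J, R := by
          apply Finset.sum_le_sum
          intro n hn
          rw [← Finset.mul_sum, ← Finset.mul_sum]
          have := sum_J_le s hs0 hs1 k J hJ n hn
          rw [hR]
          gcongr
      _ = _ := by simp
  have hlow : J.card * c ≤ ∑ m ∈ Q, ∑ n ∈ J, w n m := by
    rw [Finset.sum_comm, ← nsmul_eq_mul]
    apply Finset.card_nsmul_le_sum
    intro n hn
    refine (hall n hn).2.2.2.2.2.1.trans ?_
    exact Finset.sum_le_sum_of_subset_of_nonneg (hSQ n hn) (fun m _ _ => (hall n hn).2.2.2.1 m)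
  have hcs := sq_sum_le_card_mul_sum_sq (s := Q) (f := fun m => ∑ n ∈ J, w n m)
  have hfin : (J.card * c)^2 ≤ Q.card * (J.card * R) := by
    calc _ ≤ (∑ m ∈ Q, ∑ n ∈ J, w n m)^2 := by gcongr
      _ ≤ _ := hcs
      _ ≤ _ := by gcongr
  rw [hM]
  have hRn : 0 ≤ R := by
    have : 0 < 1 - s := by linarith
    rw [hR]; positivity
  rcases Nat.eq_zero_or_pos J.card with h | h
  · rw [h]; simp; positivity
  · have hpos : (0:ℝ) < J.card := by exact_mod_cast h
    apply le_of_mul_le_mul_left _ hpos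
    linarith

open Filter Topology in
lemma null_piece {K : Set Plane} (hb : Bornology.IsBounded K) {P : Set Plane} (u : Plane → ℝ)
    (hP : P ⊆ unitCircle) (hu1 : ∀ e ∈ P, |u e| ≤ 1)
    (hu2 : ∀ e ∈ P, ∀ f ∈ P, |u e - u f| ≤ 2 * |wedge e f|)
    (hu3 : ∀ e ∈ P, ∀ f ∈ P, dist e f ≤ 2 * |u e - u f|)
    {s c t : ℝ} (hs0 : 0 < s) (hs1 : s < 1) (hc : 0 < c) (hts : t < 2 * s)
    (hcont : ∀ e ∈ P, ∃ z, HasContent s c (K ∩ lineThrough e z))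
    (hfreq : ∃ᶠ k : ℕ in atTop, (covNum 2 k K : ℝ) ≤ ((2:ℝ)^k)^t) :
    μH[1] P = 0 := by
  classical
  obtain ⟨φ, hφ, hφM⟩ := extraction_of_frequently_atTop hfreq
  let J : ℕ → Finset ℤ := fun k => (Finset.Icc (-2^k) (2^k)).filter fun n => ∃ e ∈ P, ⌊u e * 2^k⌋ = n
  set C : ℝ := (1444 + covNum 2 0 K) * (2 * (1 + 2 / (1-s))) / c^2 with hC
  have hJcard : ∀ k, (covNum 2 k K : ℝ) ≤ ((2:ℝ)^k)^t →
      ((J k).card : ℝ) * (2 * (1/2:ℝ)^k) ≤ 2 * C * ((2:ℝ)^k)^(t - 2*s) := by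
    intro k hk
    have h1 := count_bound hb u hP hu2 hs0 hs1 hc hcont k (J k) (Finset.filter_subset _ _)
      (fun n hn => (Finset.mem_filter.1 hn).2)
    have hx : (0:ℝ) < 2^k := by positivity
    have e0 : (1/2:ℝ)^k = ((2:ℝ)^k)⁻¹ := by rw [one_div, inv_pow]
    have hs : 0 < 1 - s := by linarith
    have h2 : (J k).card * c^2 ≤ ((2:ℝ)^k)^t * (((1/2:ℝ)^k)^s * ((1444 + covNum 2 0 K) *
      ((2 * (1 + 2 / (1-s))) * ((2:ℝ)^k)^(1-s)))) := h1.trans (by gcongr)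
    have e1 : ((2:ℝ)^k)^t * (((1/2:ℝ)^k)^s * ((1444 + covNum 2 0 K) *
      ((2 * (1 + 2 / (1-s))) * ((2:ℝ)^k)^(1-s)))) = (C * ((2:ℝ)^k)^(t-2*s)) * 2^k * c^2 := by
      have e2 : ((2:ℝ)^k)^(t-2*s) * 2^k = ((2:ℝ)^k)^t * ((1/2:ℝ)^k)^s * ((2:ℝ)^k)^(1-s) := by
        rw [e0, Real.inv_rpow hx.le, ← Real.rpow_neg hx.le, ← Real.rpow_add hx, ← Real.rpow_add hx]
        nth_rewrite 2 [← Real.rpow_one ((2:ℝ)^k)]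
        rw [← Real.rpow_add hx]
        congr 1; ring
      rw [hC]
      calc _ = (1444 + (covNum 2 0 K : ℝ)) * (2 * (1 + 2 / (1-s))) * (((2:ℝ)^k)^t * ((1/2:ℝ)^k)^s * ((2:ℝ)^k)^(1-s)) := by ring
        _ = _ := by rw [← e2]; field_simp
    rw [e1] at h2
    have h3 := le_of_mul_le_mul_right h2 (by positivity)
    rw [e0]
    calc ((J k).card : ℝ) * (2 * ((2:ℝ)^k)⁻¹) ≤ (C * ((2:ℝ)^k)^(t-2*s)) * 2^k * (2 * ((2:ℝ)^k)⁻¹) := by gcongr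
      _ = _ := by field_simp
  have hpow : Tendsto (fun n => (2:ℝ)^(φ n)) atTop atTop :=
    (tendsto_pow_atTop_atTop_of_one_lt (by norm_num)).comp hφ.tendsto_atTop
  have ht1 : Tendsto (fun n => ENNReal.ofReal (2 * (1/2:ℝ)^(φ n))) atTop (𝓝 0) := by
    rw [← ENNReal.ofReal_zero]
    apply ENNReal.tendsto_ofReal
    have := ((tendsto_pow_atTop_nhds_zero_of_lt_one (r := (1/2:ℝ)) (by norm_num) (by norm_num)).comp
      hφ.tendsto_atTop).const_mul 2
    simpa using this
  have ht2 : Tendsto (fun n => ENNReal.ofReal (2 * C * ((2:ℝ)^(φ n))^(t - 2*s))) atTop (𝓝 0) := by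
    rw [← ENNReal.ofReal_zero]
    apply ENNReal.tendsto_ofReal
    have h := (tendsto_rpow_neg_atTop (y := 2*s - t) (by linarith)).comp hpow
    have := h.const_mul (2 * C)
    simpa [Function.comp_def] using this
  have hdiam : ∀ k (n : ℤ), ediam {e ∈ P | ⌊u e * 2^k⌋ = n} ≤ ENNReal.ofReal (2 * (1/2:ℝ)^k) := by
    intro k n
    apply Metric.ediam_le
    intro x hx y hy
    rw [edist_dist]
    apply ENNReal.ofReal_le_ofReal
    refine (hu3 x hx.1 y hy.1).trans ?_
    have h2 := (Int.abs_sub_lt_one_of_floor_eq_floor (hx.2.trans hy.2.symm)).le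
    rw [← sub_mul, abs_mul, abs_of_pos (by positivity : (0:ℝ) < 2^k)] at h2
    gcongr
    rw [one_div, inv_pow, ← one_div, le_div_iff₀ (by positivity)]
    exact h2
  have key := Measure.hausdorffMeasure_le_liminf_sum (ι := fun n => J (φ n)) 1 P (l := atTop)
    (fun n => ENNReal.ofReal (2 * (1/2:ℝ)^(φ n))) ht1
    (fun n i => {e ∈ P | ⌊u e * 2^(φ n)⌋ = i.1})
    (Eventually.of_forall fun n i => hdiam _ _)
    (Eventually.of_forall fun n => by
      intro x hx
      refine Set.mem_iUnion.2 ⟨⟨⌊u x * 2^(φ n)⌋, ?_⟩, hx, rfl⟩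
      refine Finset.mem_filter.2 ⟨Finset.mem_Icc.2 ⟨?_, ?_⟩, x, hx, rfl⟩
      · rw [Int.le_floor]
        push_cast
        have := (abs_le.1 (hu1 x hx)).1
        have h2 : (0:ℝ) < 2^(φ n) := by positivity
        nlinarith
      · have h3 : u x * 2^(φ n) ≤ 2^(φ n) := by
          have := (abs_le.1 (hu1 x hx)).2
          have h2 : (0:ℝ) < 2^(φ n) := by positivity
          nlinarith
        have h4 := (Int.floor_le (u x * 2^(φ n))).trans h3
        exact_mod_cast h4)
  refine le_antisymm (key.trans ?_) zero_le
  rw [← ht2.liminf_eq]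
  refine liminf_le_liminf (Eventually.of_forall fun n => ?_)
  calc _ ≤ ∑ i : J (φ n), ENNReal.ofReal (2 * (1/2:ℝ)^(φ n)) := by
        apply Finset.sum_le_sum
        intro i _
        rw [ENNReal.rpow_one]
        exact hdiam _ _
    _ = ENNReal.ofReal ((J (φ n)).card * (2 * (1/2:ℝ)^(φ n))) := by
        rw [Finset.sum_const, nsmul_eq_mul, ENNReal.ofReal_mul (by positivity)]
        simp
    _ ≤ _ := ENNReal.ofReal_le_ofReal (hJcard _ (hφM n))

lemma circle_est {a b a' b' : ℝ} (h : a^2 + b^2 = 1) (h' : a'^2 + b'^2 = 1)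
    (ha : 1/2 ≤ a^2) (ha' : 1/2 ≤ a'^2) (hp : 0 ≤ a * a') :
    |b - b'| ≤ 2 * |a * b' - b * a'| ∧ √((a - a')^2 + (b - b')^2) ≤ 2 * |b - b'| := by
  have hp2 : 1/2 ≤ a * a' := by
    by_contra hcon
    push Not at hcon
    nlinarith
  have hbb : -(1/2) ≤ b * b' := by nlinarith [sq_nonneg (b + b')]
  constructor
  · rw [show 2 * |a * b' - b * a'| = |2 * (a * b' - b * a')| by rw [abs_mul]; norm_num, ← sq_le_sq]
    have hX : (a * b' - b * a')^2 = 1 - (a * a' + b * b')^2 := by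
      have : (a * b' - b * a')^2 + (a * a' + b * b')^2 = (a^2 + b^2) * (a'^2 + b'^2) := by ring
      rw [h, h'] at this; linarith
    have hc0 : 0 ≤ a * a' + b * b' := by linarith
    have hc1 : a * a' + b * b' ≤ 1 := by nlinarith [sq_nonneg (a - a'), sq_nonneg (b - b')]
    nlinarith [sq_nonneg (a - a'), sq_nonneg (b - b')]
  · rw [Real.sqrt_le_left (by positivity)]
    have h1 : (a - a')^2 * (a + a')^2 = (b - b')^2 * (b + b')^2 := by
      have : (a - a') * (a + a') = -((b - b') * (b + b')) := by linarith
      rw [← mul_pow, ← mul_pow, this]; ring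
    have h2 : 2 ≤ (a + a')^2 := by nlinarith
    have h3 : (b + b')^2 ≤ 2 := by nlinarith [sq_nonneg (b - b')]
    have h4 : (a - a')^2 ≤ (b - b')^2 := by
      nlinarith [sq_nonneg (a - a'), sq_nonneg (b - b')]
    rw [mul_pow, sq_abs]
    nlinarith [sq_nonneg (b - b')]

theorem statement5 (K : Set Plane) (t s : ℝ)
    (hK : IsCompact K) (hsub : SubUniformlyDistributed K)
    (ht : dimH K = ENNReal.ofReal t) (ht0 : 0 < t) (ht2 : t < 2)
    (hs1 : t / 2 < s) (hs2 : s ≤ 1) :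
    ∃ E : Set Plane, E ⊆ unitCircle ∧ μH[1] E = 0 ∧
      ∀ e ∈ unitCircle \ E, ∀ z : Plane,
        ¬ ENNReal.ofReal s ≤ dimH (K ∩ lineThrough e z) := by
  have hne : K.Nonempty := by
    rw [Set.nonempty_iff_ne_empty]
    rintro rfl
    rw [dimH_empty] at ht
    exact absurd ht.symm (by simpa using ht0)
  obtain ⟨s', hs'1, hs'2⟩ := exists_between hs1
  obtain ⟨t', ht'1, ht'2⟩ := exists_between (show t < 2 * s' by linarith)
  have hs'0 : 0 < s' := by linarith
  have ht'0 : 0 < t' := by linarith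
  have h0 : μH[t'] K = 0 := by
    have := hausdorffMeasure_of_dimH_lt (s := K) (d := t'.toNNReal) (by
      rw [ht]
      exact (ENNReal.ofReal_lt_ofReal_iff ht'0).2 ht'1)
    rwa [Real.coe_toNNReal _ ht'0.le] at this
  have hfreq := box_bound K hK hne hsub t' ht'0 h0
  let E : Set Plane := {e ∈ unitCircle | ∃ z, ENNReal.ofReal s ≤ dimH (K ∩ lineThrough e z)}
  let G : ℕ → Set Plane := fun n => {e ∈ unitCircle | ∃ z, HasContent s' (1/((n:ℝ)+1)) (K ∩ lineThrough e z)}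
  have hEG : E ⊆ ⋃ n, G n := by
    rintro e ⟨he, z, hz⟩
    have h1 : μH[s'] (K ∩ lineThrough e z) = ⊤ := by
      have h2 := hausdorffMeasure_of_lt_dimH (s := K ∩ lineThrough e z) (d := s'.toNNReal)
        (lt_of_lt_of_le ((ENNReal.ofReal_lt_ofReal_iff (by linarith)).2 hs'2) hz)
      rwa [Real.coe_toNNReal _ hs'0.le] at h2
    obtain ⟨n, hn⟩ := exists_content _ s' hs'0 (by rw [h1]; simp)
    exact Set.mem_iUnion.2 ⟨n, he, z, hn⟩
  refine ⟨E, fun e he => he.1, ?_, fun e he z hz => he.2 ⟨he.1, z, hz⟩⟩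
  refine measure_mono_null hEG (measure_iUnion_null fun n => ?_)
  have hnull : ∀ P : Set Plane, ∀ u : Plane → ℝ, P ⊆ G n → (∀ e ∈ P, |u e| ≤ 1) →
      (∀ e ∈ P, ∀ f ∈ P, |u e - u f| ≤ 2 * |wedge e f| ∧ dist e f ≤ 2 * |u e - u f|) →
      μH[1] P = 0 := by
    intro P u hPG hu hu2
    exact null_piece hsub.1 u (fun e he => (hPG he).1) hu (fun e he f hf => (hu2 e he f hf).1)
      (fun e he f hf => (hu2 e he f hf).2) hs'0 (by linarith)
      (by positivity : (0:ℝ) < 1/((n:ℝ)+1)) ht'2 (fun e he => (hPG he).2) hfreq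
  have hdist : ∀ e f : Plane, dist e f = √((e 0 - f 0)^2 + (e 1 - f 1)^2) := by
    intro e f
    rw [EuclideanSpace.dist_eq, Fin.sum_univ_two]
    simp only [Real.dist_eq, sq_abs]
  have p0 : ∀ σ : ℝ, σ ≠ 0 → μH[1] {e ∈ G n | 1/2 ≤ e 0 ^ 2 ∧ 0 ≤ σ * e 0} = 0 := by
    intro σ hσ
    refine hnull _ (fun e => e 1) (fun e he => he.1) (fun e he => coord_le_one he.1.1 1) ?_
    intro e he f hf
    have hp : 0 ≤ e 0 * f 0 := by
      have := mul_nonneg he.2.2 hf.2.2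
      have h2 : 0 < σ^2 := by positivity
      nlinarith
    have := circle_est (circle_eq he.1.1) (circle_eq hf.1.1) he.2.1 hf.2.1 hp
    rw [hdist]
    exact this
  have p1 : ∀ σ : ℝ, σ ≠ 0 → μH[1] {e ∈ G n | 1/2 ≤ e 1 ^ 2 ∧ 0 ≤ σ * e 1} = 0 := by
    intro σ hσ
    refine hnull _ (fun e => e 0) (fun e he => he.1) (fun e he => coord_le_one he.1.1 0) ?_
    intro e he f hf
    have hp : 0 ≤ e 1 * f 1 := by
      have := mul_nonneg he.2.2 hf.2.2
      have h2 : 0 < σ^2 := by positivity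
      nlinarith
    have := circle_est ((add_comm _ _).trans (circle_eq he.1.1))
      ((add_comm _ _).trans (circle_eq hf.1.1)) he.2.1 hf.2.1 hp
    rw [hdist, add_comm, show wedge e f = -(e 1 * f 0 - e 0 * f 1) by simp [wedge], abs_neg]
    exact this
  refine measure_mono_null (t := ({e ∈ G n | 1/2 ≤ e 0 ^ 2 ∧ 0 ≤ (1:ℝ) * e 0} ∪ {e ∈ G n | 1/2 ≤ e 0 ^ 2 ∧ 0 ≤ (-1:ℝ) * e 0})
    ∪ ({e ∈ G n | 1/2 ≤ e 1 ^ 2 ∧ 0 ≤ (1:ℝ) * e 1} ∪ {e ∈ G n | 1/2 ≤ e 1 ^ 2 ∧ 0 ≤ (-1:ℝ) * e 1})) ?_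
    (measure_union_null (measure_union_null (p0 1 (by norm_num)) (p0 (-1) (by norm_num)))
      (measure_union_null (p1 1 (by norm_num)) (p1 (-1) (by norm_num))))
  intro e he
  have h1 := circle_eq he.1
  by_cases h : 1/2 ≤ e 0 ^ 2
  · left
    rcases le_total 0 (e 0) with h2 | h2
    · left; exact ⟨he, h, by linarith⟩
    · right; exact ⟨he, h, by linarith⟩
  · right
    have h3 : 1/2 ≤ e 1 ^ 2 := by linarith
    rcases le_total 0 (e 1) with h2 | h2
    · left; exact ⟨he, h3, by linarith⟩
    · right; exact ⟨he, h3, by linarith⟩
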